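/- Let n ≥ 2 and let q_1,…,q_n be a polygonal homographic orbit solution of the planar n-body system (with arbitrary everywhere-positive mass functions m_1,…,m_n). Then 2r'(t)·φ'(t) + r(t)·φ''(t) = 0 for all t, and consequently there exists a constant c ∈ ℝ such that r(t)²·φ'(t) = c for all t. -/

import Mathlib

open Real

/-- The velocity of a planar curve in polar coordinates. -/
theorem hasDerivAt_polar {r θ : ℝ → ℝ} {r' θ' t : ℝ}
    (hr : HasDerivAt r r' t) (hθ : HasDerivAt θ θ' t) :
    HasDerivAt (fun s => (r s * Real.cos (θ s), r s * Real.sin (θ s)))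
      (r' * Real.cos (θ t) + r t * (-Real.sin (θ t) * θ'),
        r' * Real.sin (θ t) + r t * (Real.cos (θ t) * θ')) t :=
  (hr.mul hθ.cos).prodMk (hr.mul hθ.sin)

/-- The tangential component of the acceleration of a planar curve in polar coordinates. -/
theorem tangential_acceleration_polar {r θ : ℝ → ℝ} (hr : ContDiff ℝ 2 r) (hθ : ContDiff ℝ 2 θ)
    (t : ℝ) :
    (deriv (deriv fun s => (r s * Real.cos (θ s), r s * Real.sin (θ s))) t).2 * Real.cos (θ t) -
      (deriv (deriv fun s => (r s * Real.cos (θ s), r s * Real.sin (θ s))) t).1 * Real.sin (θ t) =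
      2 * deriv r t * deriv θ t + r t * deriv (deriv θ) t := by
  have hr1 (s : ℝ) : HasDerivAt r (deriv r s) s := (hr.differentiable two_ne_zero s).hasDerivAt
  have hθ1 (s : ℝ) : HasDerivAt θ (deriv θ s) s := (hθ.differentiable two_ne_zero s).hasDerivAt
  have hr2 : HasDerivAt (deriv r) (deriv (deriv r) t) t :=
    (hr.differentiable_deriv_two t).hasDerivAt
  have hθ2 : HasDerivAt (deriv θ) (deriv (deriv θ) t) t :=
    (hθ.differentiable_deriv_two t).hasDerivAt
  have hvel : (deriv fun s => (r s * Real.cos (θ s), r s * Real.sin (θ s))) = fun s =>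
      (deriv r s * Real.cos (θ s) + r s * (-Real.sin (θ s) * deriv θ s),
        deriv r s * Real.sin (θ s) + r s * (Real.cos (θ s) * deriv θ s)) :=
    funext fun s => (hasDerivAt_polar (hr1 s) (hθ1 s)).deriv
  have hacc := ((hr2.mul (hθ1 t).cos).add ((hr1 t).mul ((hθ1 t).sin.neg.mul hθ2))).prodMk
    ((hr2.mul (hθ1 t).sin).add ((hr1 t).mul ((hθ1 t).cos.mul hθ2)))
  simp only [Pi.add_apply, Pi.neg_apply, Pi.mul_apply] at hacc
  rw [hvel, hacc.deriv]
  linear_combination (2 * deriv r t * deriv θ t + r t * deriv (deriv θ) t) *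
    Real.sin_sq_add_cos_sq (θ t)

/-- A double sum of an antisymmetric function vanishes. -/
theorem sum_sum_eq_zero_of_antisymm {ι : Type*} (s : Finset ι) (g : ι → ι → ℝ)
    (hg : ∀ i j, g i j = -g j i) : ∑ i ∈ s, ∑ j ∈ s, g i j = 0 := by
  have h : ∑ i ∈ s, ∑ j ∈ s, g i j = -∑ i ∈ s, ∑ j ∈ s, g i j := by
    conv_lhs => rw [Finset.sum_comm]
    simp only [← Finset.sum_neg_distrib]
    exact Finset.sum_congr rfl fun i _ => Finset.sum_congr rfl fun j _ => hg j i
  linarith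

/-- For a polygonal homographic orbit solution of the planar `n`-body
problem (with arbitrary everywhere-positive mass functions), `2r'φ' + rφ'' = 0` for all
`t`, and consequently `r²φ'` is constant.
Bodies are indexed by `i ∈ {0, …, n-1}`. -/
theorem homographic_angular_momentum_conservation
    (n : ℕ) (hn : 2 ≤ n)
    -- the kernel `f`, positive on `(0,∞)`
    (f : ℝ → ℝ) (hf_pos : ∀ x > 0, 0 < f x)
    -- the mass functions, everywhere positive
    (m : ℕ → ℝ → ℝ) (hm : ∀ i < n, ∀ t, 0 < m i t)
    -- the radius, twice continuously differentiable and positive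
    (r : ℝ → ℝ) (hr : ContDiff ℝ 2 r) (hr_pos : ∀ t, 0 < r t)
    -- the common rotation angle, twice continuously differentiable
    (φ : ℝ → ℝ) (hφ : ContDiff ℝ 2 φ)
    -- the constant phases, with `0 ≤ α₀ < α₁ < … < α_{n-1} < 2π`
    (α : ℕ → ℝ) (hα0 : 0 ≤ α 0)
    (hord : ∀ i j, i < j → j < n → α i < α j)
    (hα2π : ∀ i < n, α i < 2 * π)
    -- the bodies
    (q : ℕ → ℝ → ℝ × ℝ)
    (hq : ∀ i < n, ∀ t,
      q i t = (r t * Real.cos (φ t + α i), r t * Real.sin (φ t + α i)))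
    -- the equations of motion
    (hODE : ∀ i < n, ∀ t, deriv (deriv (q i)) t =
      ∑ j ∈ (Finset.range n).erase i,
        (m j t * f (((q j t).1 - (q i t).1) ^ 2 + ((q j t).2 - (q i t).2) ^ 2)) •
          (q j t - q i t)) :
    (∀ t, 2 * deriv r t * deriv φ t + r t * deriv (deriv φ) t = 0) ∧
    ∃ c : ℝ, ∀ t, r t ^ 2 * deriv φ t = c := by
  have key : ∀ t, 2 * deriv r t * deriv φ t + r t * deriv (deriv φ) t = 0 := by
    intro t
    set L := 2 * deriv r t * deriv φ t + r t * deriv (deriv φ) t with hL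
    let F : ℕ → ℕ → ℝ := fun i j =>
      f (((q j t).1 - (q i t).1) ^ 2 + ((q j t).2 - (q i t).2) ^ 2)
    have tangential : ∀ i ∈ Finset.range n,
        L = ∑ j ∈ Finset.range n, m j t * F i j * (r t * Real.sin (α j - α i)) := by
      intro i hi
      have hin := Finset.mem_range.1 hi
      have hqi : q i = fun s => (r s * Real.cos (φ s + α i), r s * Real.sin (φ s + α i)) :=
        funext (hq i hin)
      have h := tangential_acceleration_polar hr (hφ.add (contDiff_const (c := α i))) t
      have hshift : deriv (fun s => φ s + α i) = deriv φ := funext fun s => deriv_add_const _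
      rw [hshift, ← hqi, hODE i hin t, ← hL, Prod.snd_sum, Prod.fst_sum, Finset.sum_mul,
        Finset.sum_mul, ← Finset.sum_sub_distrib] at h
      rw [← h, ← Finset.sum_erase (Finset.range n) (a := i) (by simp)]
      refine Finset.sum_congr rfl fun j hj => ?_
      have hjn := Finset.mem_range.1 (Finset.mem_of_mem_erase hj)
      have hsin : Real.sin (α j - α i) = Real.sin (φ t + α j) * Real.cos (φ t + α i) -
          Real.cos (φ t + α j) * Real.sin (φ t + α i) := by
        rw [← Real.sin_sub]
        ring_nf
      simp only [F, Prod.smul_fst, Prod.smul_snd, Prod.fst_sub, Prod.snd_sub, smul_eq_mul]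
      rw [hsin, hq i hin t, hq j hjn t]
      ring
    have hsum : (∑ i ∈ Finset.range n, m i t) * L = 0 := by
      rw [Finset.sum_mul, ← sum_sum_eq_zero_of_antisymm (Finset.range n)
        (fun i j => m i t * (m j t * F i j * (r t * Real.sin (α j - α i))))]
      · refine Finset.sum_congr rfl fun i hi => ?_
        rw [← Finset.mul_sum, ← tangential i hi]
      · intro i j
        have hF : F i j = F j i := by
          simp only [F]
          ring_nf
        rw [hF, ← neg_sub (α i) (α j), Real.sin_neg]
        ring
    have hmass : 0 < ∑ i ∈ Finset.range n, m i t :=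
      Finset.sum_pos (fun i hi => hm i (Finset.mem_range.1 hi) t)
        (Finset.nonempty_range_iff.2 (by lia))
    exact (mul_eq_zero.1 hsum).resolve_left hmass.ne'
  refine ⟨key, r 0 ^ 2 * deriv φ 0, fun t => ?_⟩
  have hderiv (s : ℝ) : HasDerivAt (fun s => r s ^ 2 * deriv φ s) 0 s := by
    have hr1 := (hr.differentiable two_ne_zero s).hasDerivAt
    have hφ2 := (hφ.differentiable_deriv_two s).hasDerivAt
    refine ((hr1.pow 2).mul hφ2).congr_deriv ?_
    simp only [Pi.pow_apply]
    linear_combination r s * key s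
  exact is_const_of_deriv_eq_zero (fun s => (hderiv s).differentiableAt)
    (fun s => (hderiv s).deriv) t 0
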